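/- arXiv:1107.2392 — 3 statements merged into one kernel-verified Lean document; each statement's English description precedes it below -/
import Mathlib

section
/- Let λ be a partition of length at most n, with Müntz tableau partitions λ⁽ᵏ⁾ defined by λ⁽⁰⁾ = (λ₂,…,λₙ), λ⁽ⁱ⁾ = (λ₁+1,…,λ_i+1, λ_{i+2},…,λₙ) for 1 ≤ i ≤ n−1, and λ⁽ⁿ⁾ = (λ₁+1,…,λₙ+1). Then for 1 ≤ k ≤ n−1 and variables U = (u₁,…,u_{n−1}), x, y: S_{λ⁽⁰⁾}(U,x)·S_{λ⁽ᵏ⁾}(U,y) − S_{λ⁽⁰⁾}(U,y)·S_{λ⁽ᵏ⁾}(U,x) = (y−x)·S_η(U)·S_λ(U,x,y), where η = (λ₂+1,…,λ_k+1, λ_{k+2},…,λₙ). -/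
/-- Complete homogeneous symmetric polynomial of degree `m` in `n` real variables. -/
noncomputable def hh (n m : ℕ) (u : Fin n → ℝ) : ℝ :=
  ∑ c ∈ Finset.Nat.antidiagonalTuple n m, ∏ i, u i ^ c i

/-- `hh` extended by `0` to negative degrees. -/
noncomputable def hZ (n : ℕ) (m : ℤ) (u : Fin n → ℝ) : ℝ :=
  if 0 ≤ m then hh n m.toNat u else 0

/-- Schur polynomial of the partition `lam` (of length at most `l`), evaluated at `k`
real variables, defined via the Jacobi–Trudi determinant. -/
noncomputable def schur {l : ℕ} (lam : Fin l → ℕ) {k : ℕ} (u : Fin k → ℝ) : ℝ :=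
  Matrix.det (Matrix.of fun i j : Fin l => hZ k ((lam i : ℤ) - (i : ℤ) + (j : ℤ)) u)

open Matrix in
theorem aux_plucker {ι : Type*} [Fintype ι] [DecidableEq ι] (M : Matrix ι ι ℝ) (p k : ι)
    (hpk : p ≠ k) (v w : ι → ℝ) :
    ((M.updateRow p v).updateRow k w).det * M.det
      = (M.updateRow p v).det * (M.updateRow k w).det
        - (M.updateRow p w).det * (M.updateRow k v).det := by
  have h := Matrix.mulVec_cramer Mᵀ w
  have h2 : Mᵀ.det • w = ∑ i, (cramer Mᵀ w i) • M i := by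
    rw [← h]
    ext j
    simp [Matrix.mulVec, dotProduct, Finset.sum_apply, mul_comm]
  have h3 := congrArg (fun z => cramer (M.updateRow p v)ᵀ z k) h2
  simp only [map_smul, map_sum, Finset.sum_apply, Pi.smul_apply, smul_eq_mul] at h3
  simp only [cramer_transpose_apply, det_transpose] at h3
  rw [mul_comm, h3, Finset.sum_eq_add_of_mem k p (Finset.mem_univ _) (Finset.mem_univ _) hpk.symm]
  · have e1 : (M.updateRow p v).updateRow k (M k) = M.updateRow p v := by
      ext i j
      by_cases hi : i = k
      · subst hi; simp [Matrix.updateRow_apply, hpk.symm]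
      · simp [Matrix.updateRow_apply, hi]
    have e2 : ((M.updateRow p v).updateRow k (M p)).det = - (M.updateRow k v).det := by
      have e3 : (M.updateRow p v).updateRow k (M p)
          = (M.updateRow k v).submatrix (Equiv.swap p k) id := by
        ext i j
        by_cases hi : i = k
        · subst hi; simp [Matrix.updateRow_apply, hpk]
        · by_cases hi' : i = p
          · subst hi'; simp [Matrix.updateRow_apply, hpk]
          · simp [Matrix.updateRow_apply, hi, hi', Equiv.swap_apply_of_ne_of_ne hi' hi]
      rw [e3, Matrix.det_permute, Equiv.Perm.sign_swap hpk]
      simp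
    rw [e1, e2]
    ring
  · intro c _ hc
    have : ((M.updateRow p v).updateRow k (M c)).det = 0 := by
      apply det_zero_of_row_eq (i := k) (j := c) hc.1.symm
      ext j
      simp [Matrix.updateRow_apply, hc.1, hc.2]
    rw [this, mul_zero]

theorem aux_row {n : ℕ} (M : Matrix (Fin (n + 1)) (Fin (n + 1)) ℝ) (k : Fin (n + 1)) (t : ℝ)
    (h : ∀ j, M k j = t ^ (j : ℕ)) :
    M.det = (-1) ^ (k : ℕ) * Matrix.det (Matrix.of fun i j : Fin n =>
      M (k.succAbove i) j.succ - t * M (k.succAbove i) j.castSucc) := by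
  have h1 : M.det = Matrix.det (Matrix.of fun i j : Fin (n + 1) =>
      (Fin.cases (M i 0) (fun j' => M i j'.succ - t * M i j'.castSucc) j : ℝ)) := by
    apply Matrix.det_eq_of_forall_col_eq_smul_add_pred (fun _ => t)
    · intro i; simp
    · intro i j; simp
  rw [h1, Matrix.det_succ_row _ k, Fin.sum_univ_succ, Finset.sum_eq_zero]
  · simp only [Matrix.of_apply, Fin.cases_zero, h, Fin.val_zero, pow_zero, add_zero, mul_one]
    congr 2
  · intro j _
    simp [h, pow_succ, mul_comm]

open PowerSeries in
theorem aux_hh (n m : ℕ) (u : Fin n → ℝ) :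
    hh n m u = coeff m (∏ i, (PowerSeries.mk fun j => u i ^ j)) := by
  rw [PowerSeries.coeff_prod, hh, ← Finset.piAntidiag_univ_fin_eq_antidiagonalTuple]
  symm
  refine Finset.sum_bij (fun l _ => (l : Fin n → ℕ)) ?_ ?_ ?_ ?_
  · intro l hl
    simpa using hl
  · intro a _ b _ hab
    exact DFunLike.coe_injective hab
  · intro b hb
    refine ⟨Finsupp.equivFunOnFinite.symm b, ?_, by simp⟩
    simpa using hb
  · intro l _
    simp

open PowerSeries in
theorem aux_geom (x : ℝ) : (PowerSeries.mk fun j => x ^ j) * (1 - C x * X) = 1 := by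
  ext m
  cases m with
  | zero => simp [mul_sub, ← mul_assoc]
  | succ m => simp [mul_sub, ← mul_assoc, coeff_succ_mul_X, pow_succ, coeff_one]

open PowerSeries in
theorem aux_hZ_of {n n' : ℕ} (u : Fin n → ℝ) (w : Fin n' → ℝ) (t : ℝ)
    (h : (∏ i, (PowerSeries.mk fun j => w i ^ j)) * (1 - C t * X)
      = ∏ i, (PowerSeries.mk fun j => u i ^ j)) (m : ℤ) :
    hZ n' (m + 1) w - t * hZ n' m w = hZ n (m + 1) u := by
  unfold hZ
  rcases lt_trichotomy m (-1) with hm | hm | hm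
  · rw [if_neg (by omega), if_neg (by omega), if_neg (by omega)]; simp
  · subst hm
    simp only [aux_hh, ← h]
    simp [mul_sub, ← mul_assoc]
  · lift m to ℕ using by omega
    rw [if_pos (by omega), if_pos (by omega), if_pos (by omega)]
    have : ((m : ℤ) + 1).toNat = m + 1 := by omega
    rw [this, Int.toNat_natCast]
    simp only [aux_hh, ← h]
    rw [mul_sub, mul_one, map_sub, ← mul_assoc, coeff_succ_mul_X, mul_comm _ (C t), coeff_C_mul]

theorem aux_hZ1 {n : ℕ} (u : Fin n → ℝ) (x : ℝ) (m : ℤ) :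
    hZ (n + 1) (m + 1) (Fin.snoc u x : Fin (n + 1) → ℝ)
      - x * hZ (n + 1) m (Fin.snoc u x : Fin (n + 1) → ℝ) = hZ n (m + 1) u := by
  apply aux_hZ_of
  rw [Fin.prod_univ_castSucc]
  simp only [Fin.snoc_castSucc, Fin.snoc_last]
  rw [mul_assoc, aux_geom, mul_one]

theorem aux_hZ2 {n : ℕ} (u : Fin n → ℝ) (x y : ℝ) (m : ℤ) :
    hZ (n + 2) (m + 1) (Fin.snoc (Fin.snoc u x : Fin (n + 1) → ℝ) y : Fin (n + 2) → ℝ)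
      - x * hZ (n + 2) m (Fin.snoc (Fin.snoc u x : Fin (n + 1) → ℝ) y : Fin (n + 2) → ℝ)
      = hZ (n + 1) (m + 1) (Fin.snoc u y : Fin (n + 1) → ℝ) := by
  apply aux_hZ_of
  rw [Fin.prod_univ_castSucc, Fin.prod_univ_castSucc, Fin.prod_univ_castSucc]
  simp only [Fin.snoc_castSucc, Fin.snoc_last]
  rw [mul_right_comm, mul_assoc (∏ i, _), aux_geom, mul_one]

/-- Müntz tableau identity: for a partition `λ` of length at most `n+2`, `1 ≤ k ≤ n+1`,
with `λ⁽⁰⁾ = (λ₂,…)`, `λ⁽ᵏ⁾ = (λ₁+1,…,λ_k+1,λ_{k+2},…)` and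
`η = (λ₂+1,…,λ_k+1,λ_{k+2},…)` (the bottom partition of `λ⁽ᵏ⁾`):
`S_{λ⁽⁰⁾}(U,x)·S_{λ⁽ᵏ⁾}(U,y) − S_{λ⁽⁰⁾}(U,y)·S_{λ⁽ᵏ⁾}(U,x) = (y−x)·S_η(U)·S_λ(U,x,y)`. -/
theorem schur_muntz_tableau_condensation (n : ℕ) (lam : Fin (n + 2) → ℕ) (hlam : Antitone lam)
    (k : ℕ) (hk1 : 1 ≤ k) (hk2 : k ≤ n + 1) (U : Fin (n + 1) → ℝ) (x y : ℝ) :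
    schur (fun i : Fin (n + 1) => lam i.succ) (Fin.snoc U x : Fin (n + 2) → ℝ) *
        schur (fun i : Fin (n + 1) => if (i : ℕ) < k then lam i.castSucc + 1 else lam i.succ)
          (Fin.snoc U y : Fin (n + 2) → ℝ)
      - schur (fun i : Fin (n + 1) => lam i.succ) (Fin.snoc U y : Fin (n + 2) → ℝ) *
          schur (fun i : Fin (n + 1) => if (i : ℕ) < k then lam i.castSucc + 1 else lam i.succ)
            (Fin.snoc U x : Fin (n + 2) → ℝ)
      = (y - x)
          * schur (fun i : Fin n => if (i : ℕ) + 1 < k then lam i.succ.castSucc + 1 else lam i.succ.succ) U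
          * schur lam (Fin.snoc (Fin.snoc U x : Fin (n + 2) → ℝ) y : Fin (n + 3) → ℝ) := by
  obtain ⟨k, rfl⟩ : ∃ k', k = k' + 1 := ⟨k - 1, by omega⟩
  set W : Fin (n + 3) → ℝ := Fin.snoc (Fin.snoc U x : Fin (n + 2) → ℝ) y with hW
  have Hx : ∀ m : ℤ, hZ (n + 3) (m + 1) W - x * hZ (n + 3) m W
      = hZ (n + 2) (m + 1) (Fin.snoc U y : Fin (n + 2) → ℝ) := aux_hZ2 U x y
  have Hy : ∀ m : ℤ, hZ (n + 3) (m + 1) W - y * hZ (n + 3) m W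
      = hZ (n + 2) (m + 1) (Fin.snoc U x : Fin (n + 2) → ℝ) := aux_hZ1 _ y
  have Hxx : ∀ m : ℤ, hZ (n + 2) (m + 1) (Fin.snoc U x : Fin (n + 2) → ℝ)
      - x * hZ (n + 2) m (Fin.snoc U x : Fin (n + 2) → ℝ) = hZ (n + 1) (m + 1) U := aux_hZ1 U x
  set M : Matrix (Fin (n + 2)) (Fin (n + 2)) ℝ :=
    Matrix.of fun i j => hZ (n + 3) ((lam i : ℤ) - (i : ℤ) + (j : ℤ)) W with hM
  set K : Fin (n + 2) := (⟨k, by omega⟩ : Fin (n + 1)).succ with hK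
  have hK0 : (0 : Fin (n + 2)) ≠ K := (Fin.succ_ne_zero _).symm
  have hKv : (K : ℕ) = k + 1 := rfl
  let r : ℝ → Fin (n + 2) → ℝ := fun t j => t ^ (j : ℕ)
  have P := aux_plucker M 0 K hK0 (r x) (r y)
  -- rows with index 0 replaced
  have D0 : ∀ (t s : ℝ), (∀ m : ℤ, hZ (n + 3) (m + 1) W - t * hZ (n + 3) m W
      = hZ (n + 2) (m + 1) (Fin.snoc U s : Fin (n + 2) → ℝ)) →
      (M.updateRow 0 (r t)).det
        = schur (fun i : Fin (n + 1) => lam i.succ) (Fin.snoc U s : Fin (n + 2) → ℝ) := by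
    intro t s h
    rw [aux_row _ 0 t (by intro j; simp [r]), schur]
    simp only [Fin.val_zero, pow_zero, one_mul]
    congr 1
    ext i j
    simp only [Matrix.of_apply, Fin.zero_succAbove, Matrix.updateRow_ne (Fin.succ_ne_zero i), hM]
    have := h ((lam i.succ : ℤ) - (i.succ : ℕ) + (j : ℕ))
    simp only [Fin.val_succ, Fin.val_castSucc, Nat.cast_add, Nat.cast_one] at this ⊢
    rw [← add_assoc, this]
    congr 1; ring
  -- index of the rows other than `K`
  have hsA : ∀ i : Fin (n + 1),
      (((if (i : ℕ) < k + 1 then lam i.castSucc + 1 else lam i.succ : ℕ)) : ℤ) - (i : ℕ)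
        = (lam (K.succAbove i) : ℤ) - ((K.succAbove i : Fin (n + 2)) : ℕ) + 1 := by
    intro i
    by_cases hi : (i : ℕ) < k + 1
    · rw [if_pos hi, Fin.succAbove_of_castSucc_lt _ _ (by rw [Fin.lt_def]; simpa [hKv] using hi)]
      simp; ring
    · rw [if_neg hi, Fin.succAbove_of_le_castSucc _ _ (by rw [Fin.le_def]; simp [hKv]; omega)]
      simp; ring
  have DK : ∀ (t s : ℝ), (∀ m : ℤ, hZ (n + 3) (m + 1) W - t * hZ (n + 3) m W
      = hZ (n + 2) (m + 1) (Fin.snoc U s : Fin (n + 2) → ℝ)) →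
      (M.updateRow K (r t)).det = (-1) ^ (k + 1) *
        schur (fun i : Fin (n + 1) => if (i : ℕ) < k + 1 then lam i.castSucc + 1 else lam i.succ)
          (Fin.snoc U s : Fin (n + 2) → ℝ) := by
    intro t s h
    rw [aux_row _ K t (by intro j; simp [r]), schur, hKv]
    congr 2
    ext i j
    simp only [Matrix.of_apply, Matrix.updateRow_ne (Fin.succAbove_ne K i), hM]
    rw [hsA]
    have := h ((lam (K.succAbove i) : ℤ) - ((K.succAbove i : Fin (n + 2)) : ℕ) + (j : ℕ))
    simp only [Fin.val_succ, Fin.val_castSucc, Nat.cast_add, Nat.cast_one] at this ⊢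
    rw [← add_assoc, this]
    congr 1; ring
  have hsB : ∀ i : Fin n,
      (((if (i : ℕ) + 1 < k + 1 then lam i.succ.castSucc + 1 else lam i.succ.succ : ℕ)) : ℤ) - (i : ℕ)
        = (lam (K.succAbove i.succ) : ℤ) - ((K.succAbove i.succ : Fin (n + 2)) : ℕ) + 2 := by
    intro i
    have := hsA i.succ
    rw [Fin.val_succ] at this
    push_cast at this ⊢
    linarith
  have hs0 : K.succAbove 0 = 0 := Fin.succAbove_ne_zero_zero hK0.symm
  have D2 : ((M.updateRow 0 (r x)).updateRow K (r y)).det = (-1) ^ (k + 1) * ((x - y) *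
      schur (fun i : Fin n => if (i : ℕ) + 1 < k + 1 then lam i.succ.castSucc + 1
        else lam i.succ.succ) U) := by
    rw [aux_row _ K y (by intro j; simp [r]), hKv]
    congr 1
    set Q := Matrix.of fun i j : Fin (n + 1) =>
      ((M.updateRow 0 (r x)).updateRow K (r y)) (K.succAbove i) j.succ
        - y * ((M.updateRow 0 (r x)).updateRow K (r y)) (K.succAbove i) j.castSucc with hQ
    have hQ0 : Q = Q.updateRow 0 ((x - y) • fun j : Fin (n + 1) => x ^ (j : ℕ)) := by
      ext i j
      by_cases hi : i = 0
      · subst hi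
        simp only [Matrix.updateRow_self, hQ, Matrix.of_apply,
          Matrix.updateRow_ne (Fin.succAbove_ne K 0)]
        simp [hs0, r, pow_succ]; ring
      · rw [Matrix.updateRow_ne hi]
    rw [hQ0, Matrix.det_updateRow_smul]
    congr 1
    rw [aux_row _ 0 x (by intro j; simp), schur]
    simp only [Fin.val_zero, pow_zero, one_mul]
    congr 1
    ext i j
    have hne : K.succAbove i.succ ≠ 0 := by
      rw [← hs0]; exact fun h => Fin.succ_ne_zero i (Fin.succAbove_right_injective h)
    simp only [Matrix.of_apply, Fin.zero_succAbove, Matrix.updateRow_ne (Fin.succ_ne_zero i), hQ,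
      Matrix.updateRow_ne (Fin.succAbove_ne K i.succ), Matrix.updateRow_ne hne, hM]
    rw [hsB]
    generalize (lam (K.succAbove i.succ) : ℤ) - ((K.succAbove i.succ : Fin (n + 2)) : ℕ) = a
    have h1 := Hy (a + j + 1)
    have h2 := Hy (a + j)
    have h3 := Hxx (a + j + 1)
    simp only [Fin.val_succ, Fin.val_castSucc, Nat.cast_add, Nat.cast_one]
    rw [← h1, ← h2] at h3
    have e1 : a + 2 + (j : ℤ) = a + j + 1 + 1 := by ring
    have e2 : a + ((j : ℤ) + 1 + 1) = a + j + 1 + 1 := by ring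
    have e3 : a + ((j : ℤ) + 1) = a + j + 1 := by ring
    rw [e1, e2, e3]
    exact h3
  rw [D0 x y Hx, D0 y x Hy, DK x y Hx, DK y x (by exact Hy), D2] at P
  have hS : schur lam W = M.det := rfl
  rw [hS]
  have P' : (-1 : ℝ) ^ (k + 1) = 1 ∨ (-1 : ℝ) ^ (k + 1) = -1 := neg_one_pow_eq_or ℝ (k + 1)
  rcases P' with h | h <;> rw [h] at P <;> linarith
end

section
/- Let λ = (λ₁,…,λₙ) be a partition of length at most n and μ its border complement. For positive reals u₁,…,u_{n−1}, a, b, t: a(b−t)t^{λ₁−1}·S_μ(U,a,ab/t)·S_λ(U,b) + b(t−a)t^{λ₁−1}·S_μ(U,b,ab/t)·S_λ(U,a) = (b−a)·t^{λ₁}·S_μ(U,a,b)·S_λ(U,ab/t), where U = (u₁,…,u_{n−1}). -/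
lemma hh_cons_succ (n k : ℕ) (x : ℝ) (V : Fin n → ℝ) :
    hh (n+1) (k+1) (Fin.cons x V : Fin (n+1) → ℝ)
      = hh n (k+1) V + x * hh (n+1) k (Fin.cons x V : Fin (n+1) → ℝ) := by
  have key : ∀ k, hh (n+1) k (Fin.cons x V : Fin (n+1) → ℝ)
      = ∑ p ∈ Finset.HasAntidiagonal.antidiagonal k, x ^ p.1 * hh n p.2 V := by
    intro k
    unfold hh
    simp only [Finset.Nat.antidiagonalTuple, Finset.sum, Multiset.Nat.antidiagonalTuple,
      List.Nat.antidiagonalTuple]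
    simp [Finset.HasAntidiagonal.antidiagonal, Multiset.Nat.antidiagonal, List.map_flatMap, List.flatMap,
      List.sum_flatten, Fin.prod_univ_succ, Function.comp_def, List.sum_map_mul_left]
  rw [key, key, Finset.Nat.antidiagonal_succ, Finset.sum_cons, Finset.sum_map, Finset.mul_sum]
  simp [pow_succ]
  refine Finset.sum_congr rfl fun p _ => by ring

lemma hh_zero (n : ℕ) (u : Fin n → ℝ) : hh n 0 u = 1 := by
  simp [hh, Finset.Nat.antidiagonalTuple_zero_right]

lemma hh_rev (n k : ℕ) (u : Fin n → ℝ) : hh n k (fun i => u i.rev) = hh n k u := by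
  unfold hh
  refine Finset.sum_bij' (fun c _ => fun i => c i.rev) (fun c _ => fun i => c i.rev) ?_ ?_ ?_ ?_ ?_
  · intro c hc
    rw [Finset.Nat.mem_antidiagonalTuple] at hc ⊢
    rw [← hc]
    exact Equiv.sum_comp Fin.revPerm c
  · intro c hc
    rw [Finset.Nat.mem_antidiagonalTuple] at hc ⊢
    rw [← hc]
    exact Equiv.sum_comp Fin.revPerm c
  · intro c _; simp
  · intro c _; simp
  · intro c _
    rw [← Equiv.prod_comp Fin.revPerm]
    simp

lemma hh_snoc_succ (n k : ℕ) (x : ℝ) (V : Fin n → ℝ) :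
    hh (n+1) (k+1) (Fin.snoc V x : Fin (n+1) → ℝ)
      = hh n (k+1) V + x * hh (n+1) k (Fin.snoc V x : Fin (n+1) → ℝ) := by
  have h : (fun i : Fin (n+1) => (Fin.snoc V x : Fin (n+1) → ℝ) i.rev)
      = (Fin.cons x (fun i => V i.rev) : Fin (n+1) → ℝ) := by
    funext i
    refine Fin.cases ?_ (fun j => ?_) i
    · simp
    · simp [Fin.rev_succ]
  rw [← hh_rev (n+1) (k+1), ← hh_rev (n+1) k, ← hh_rev n (k+1), h, hh_cons_succ]

lemma hZ_neg (n : ℕ) (k : ℤ) (hk : k < 0) (u : Fin n → ℝ) : hZ n k u = 0 := by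
  unfold hZ; rw [if_neg (by omega)]

lemma hZ_zero (n : ℕ) (u : Fin n → ℝ) : hZ n 0 u = 1 := by
  simp [hZ, hh_zero]

lemma hZ_nat (n : ℕ) (k : ℕ) (u : Fin n → ℝ) : hZ n k u = hh n k u := by
  simp [hZ]

lemma hZ_snoc (n : ℕ) (k : ℤ) (x : ℝ) (V : Fin n → ℝ) :
    hZ (n+1) (k+1) (Fin.snoc V x : Fin (n+1) → ℝ)
      = hZ n (k+1) V + x * hZ (n+1) k (Fin.snoc V x : Fin (n+1) → ℝ) := by
  rcases lt_trichotomy k (-1) with h | h | h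
  · rw [hZ_neg _ _ (by omega), hZ_neg _ _ (by omega), hZ_neg _ _ (by omega)]; simp
  · subst h
    rw [hZ_neg _ (-1) (by omega)]; simp [hZ_zero]
  · obtain ⟨j, rfl⟩ := Int.eq_ofNat_of_zero_le (show 0 ≤ k by omega)
    have := hh_snoc_succ n j x V
    rw [← hZ_nat, ← hZ_nat, ← hZ_nat] at this
    exact_mod_cast this

lemma hZ_diff (n : ℕ) (k : ℤ) (x y : ℝ) (V : Fin n → ℝ) :
    (x - y) * hZ (n+2) k (Fin.snoc (Fin.snoc V x : Fin (n+1) → ℝ) y : Fin (n+2) → ℝ)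
      = hZ (n+1) (k+1) (Fin.snoc V x : Fin (n+1) → ℝ)
        - hZ (n+1) (k+1) (Fin.snoc V y : Fin (n+1) → ℝ) := by
  have main : ∀ j : ℕ, (x - y) * hZ (n+2) ((j:ℤ) - 1)
        (Fin.snoc (Fin.snoc V x : Fin (n+1) → ℝ) y : Fin (n+2) → ℝ)
      = hZ (n+1) j (Fin.snoc V x : Fin (n+1) → ℝ)
        - hZ (n+1) j (Fin.snoc V y : Fin (n+1) → ℝ) := by
    intro j
    induction j with
    | zero => simp [hZ_zero, hZ_neg]
    | succ j ih =>
      push_cast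
      rw [hZ_snoc n j x, hZ_snoc n j y]
      have h2 := hZ_snoc (n+1) ((j:ℤ) - 1) y (Fin.snoc V x)
      rw [sub_add_cancel] at h2
      rw [add_sub_cancel_right, h2]
      linear_combination y * ih
  rcases lt_or_ge k (-1) with h | h
  · rw [hZ_neg _ _ (by omega), hZ_neg _ _ (by omega), hZ_neg _ _ (by omega)]; simp
  · obtain ⟨j, hj⟩ := Int.eq_ofNat_of_zero_le (show 0 ≤ k + 1 by omega)
    have := main j
    rw [← hj, add_sub_cancel_right] at this
    exact this

lemma det_cons_linear (n : ℕ) (W : Fin n → Fin (n+1) → ℝ) :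
    ∃ α : Fin (n+1) → ℝ, ∀ x : Fin (n+1) → ℝ,
      Matrix.det (Matrix.of (Fin.cons x W : Fin (n+1) → Fin (n+1) → ℝ)) = ∑ j, x j * α j := by
  refine ⟨fun j => (-1) ^ (j : ℕ) * Matrix.det (Matrix.of fun i k => W i (j.succAbove k)), ?_⟩
  intro x
  rw [Matrix.det_succ_row_zero]
  refine Finset.sum_congr rfl fun j _ => ?_
  have : (Matrix.of (Fin.cons x W : Fin (n+1) → Fin (n+1) → ℝ)).submatrix Fin.succ j.succAbove
      = Matrix.of fun i k => W i (j.succAbove k) := by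
    ext i k; simp
  rw [this]; simp; ring

/-- three-term Plücker relation -/
lemma plucker (n : ℕ) (W : Fin (n+1) → Fin (n+2) → ℝ) (D : (Fin (n+2) → ℝ) → (Fin (n+2) → ℝ) → ℝ)
    (hD : ∀ p q, D p q = Matrix.det (Matrix.of
      (Fin.cons p (Fin.cons q (fun j : Fin n => W j.castSucc) : Fin (n+1) → Fin (n+2) → ℝ)
        : Fin (n+2) → Fin (n+2) → ℝ)))
    (φ : (Fin (n+2) → ℝ) → ℝ)
    (hφ : ∀ p, φ p = Matrix.det (Matrix.of (Fin.cons p W : Fin (n+2) → Fin (n+2) → ℝ)))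
    (p q r : Fin (n+2) → ℝ) :
    φ p * D q r - φ q * D p r + φ r * D p q = 0 := by
  obtain ⟨α, hα⟩ := det_cons_linear (n+1) W
  have hW : ∀ j, φ (W j) = 0 := by
    intro j
    rw [hφ]
    refine Matrix.det_zero_of_row_eq (i := 0) (j := j.succ) (Fin.succ_ne_zero j).symm ?_
    funext k; simp
  let w : Fin n → Fin (n+2) → ℝ := fun j => W j.castSucc
  let R : Fin (n+3) → Fin (n+2) → ℝ := Fin.cons p (Fin.cons q (Fin.cons r w : Fin (n+1) → Fin (n+2) → ℝ) : Fin (n+2) → Fin (n+2) → ℝ)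
  let M : Matrix (Fin (n+3)) (Fin (n+3)) ℝ := Matrix.of fun i => Fin.cons (φ (R i)) (R i)
  have hM : M.det = 0 := by
    rw [← Matrix.exists_mulVec_eq_zero_iff]
    refine ⟨Fin.cons (-1) α, ?_, ?_⟩
    · intro h
      have := congrFun h 0
      simp at this
    · funext i
      simp only [Matrix.mulVec, dotProduct, M, Matrix.of_apply]
      rw [Fin.sum_univ_succ]
      simp [hφ, hα]
  rw [Matrix.det_succ_column_zero, Fin.sum_univ_succ, Fin.sum_univ_succ, Fin.sum_univ_succ] at hM
  have hz : ∀ i : Fin n, M i.succ.succ.succ 0 = 0 := by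
    intro i
    simpa [M, R, w] using hW i.castSucc
  have e0 : M.submatrix (Fin.succAbove 0) Fin.succ = Matrix.of
      (Fin.cons q (Fin.cons r w : Fin (n+1) → Fin (n+2) → ℝ) : Fin (n+2) → Fin (n+2) → ℝ) := by
    ext i k
    simp [M, R]
  have e1 : M.submatrix (Fin.succAbove (Fin.succ 0)) Fin.succ = Matrix.of
      (Fin.cons p (Fin.cons r w : Fin (n+1) → Fin (n+2) → ℝ) : Fin (n+2) → Fin (n+2) → ℝ) := by
    ext i k
    refine Fin.cases ?_ (fun i => ?_) i
    · simp [M, R]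
    · simp only [Matrix.submatrix_apply, M, R, Matrix.of_apply, Fin.cons_succ, Fin.succ_succAbove_succ, Fin.succAbove_zero]
  have e2 : M.submatrix (Fin.succAbove (Fin.succ (Fin.succ 0))) Fin.succ = Matrix.of
      (Fin.cons p (Fin.cons q w : Fin (n+1) → Fin (n+2) → ℝ) : Fin (n+2) → Fin (n+2) → ℝ) := by
    ext i k
    refine Fin.cases ?_ (fun i => Fin.cases ?_ (fun i => ?_) i) i
    · simp only [Matrix.submatrix_apply, M, R, Matrix.of_apply, Fin.cons_succ, Fin.succ_succAbove_zero, Fin.cons_zero]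
    · simp only [Matrix.submatrix_apply, M, R, Matrix.of_apply, Fin.cons_succ, Fin.succ_succAbove_succ, Fin.succAbove_zero, Fin.succ_succAbove_zero, Fin.cons_zero]
    · simp only [Matrix.submatrix_apply, M, R, Matrix.of_apply, Fin.cons_succ, Fin.succ_succAbove_succ, Fin.succAbove_zero]
  rw [e0, e1, e2] at hM
  simp only [hz] at hM
  rw [hD, hD, hD]
  have m0 : M 0 0 = φ p := rfl
  have m1 : M (Fin.succ 0) 0 = φ q := rfl
  have m2 : M (Fin.succ (Fin.succ 0)) 0 = φ r := rfl
  rw [m0, m1, m2] at hM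
  simp only [Fin.val_succ, Fin.val_zero, mul_zero, zero_mul, Finset.sum_const_zero] at hM
  linear_combination hM

lemma schur_pos_snoc (l m : ℕ) (lam : Fin (l+1) → ℕ) (U : Fin m → ℝ) (x : ℝ) :
    schur lam (Fin.snoc U x : Fin (m+1) → ℝ)
      = Matrix.det (Matrix.of (Fin.cons
          (fun i => hZ (m+1) ((lam i : ℤ) - (i : ℤ)) (Fin.snoc U x : Fin (m+1) → ℝ))
          (fun (j : Fin l) i => hZ m ((lam i : ℤ) - (i : ℤ) + j + 1) U)
          : Fin (l+1) → Fin (l+1) → ℝ)) := by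
  rw [← Matrix.det_transpose (Matrix.of (Fin.cons _ _))]
  unfold schur
  refine Matrix.det_eq_of_forall_col_eq_smul_add_pred (fun _ => x) ?_ ?_
  · intro i; simp
  · intro i j
    simp only [Matrix.of_apply, Matrix.transpose_apply, Fin.cons_succ, Fin.val_succ,
      Fin.val_castSucc]
    push_cast
    rw [← add_assoc, hZ_snoc]

lemma schur_pos_snoc2 (l m : ℕ) (lam : Fin (l+2) → ℕ) (hl : ∀ i, 1 ≤ lam i)
    (U : Fin m → ℝ) (x y : ℝ) :
    schur (fun i => lam i - 1) (Fin.snoc (Fin.snoc U x : Fin (m+1) → ℝ) y : Fin (m+2) → ℝ)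
      = Matrix.det (Matrix.of (Fin.cons
          (fun i => hZ (m+2) ((lam i : ℤ) - (i : ℤ) - 1)
            (Fin.snoc (Fin.snoc U x : Fin (m+1) → ℝ) y : Fin (m+2) → ℝ))
          (Fin.cons (fun i => hZ (m+1) ((lam i : ℤ) - (i : ℤ)) (Fin.snoc U x : Fin (m+1) → ℝ))
          (fun (j : Fin l) i => hZ m ((lam i : ℤ) - (i : ℤ) + j + 1) U)
          : Fin (l+1) → Fin (l+2) → ℝ) : Fin (l+2) → Fin (l+2) → ℝ)) := by
  rw [← Matrix.det_transpose (Matrix.of (Fin.cons _ _))]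
  have h1 : schur (fun i => lam i - 1) (Fin.snoc (Fin.snoc U x : Fin (m+1) → ℝ) y : Fin (m+2) → ℝ)
      = Matrix.det (Matrix.transpose (Matrix.of (Fin.cons
          (fun i => hZ (m+2) ((lam i : ℤ) - (i : ℤ) - 1)
            (Fin.snoc (Fin.snoc U x : Fin (m+1) → ℝ) y : Fin (m+2) → ℝ))
          (fun (j : Fin (l+1)) i => hZ (m+1) ((lam i : ℤ) - (i : ℤ) + j)
            (Fin.snoc U x : Fin (m+1) → ℝ))
          : Fin (l+2) → Fin (l+2) → ℝ))) := by
    unfold schur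
    refine Matrix.det_eq_of_forall_col_eq_smul_add_pred (fun _ => y) ?_ ?_
    · intro i
      simp only [Matrix.of_apply, Matrix.transpose_apply, Fin.cons_zero, Fin.val_zero]
      congr 1
      have := hl i
      push_cast [this]; ring
    · intro i j
      simp only [Matrix.of_apply, Matrix.transpose_apply, Fin.cons_succ, Fin.val_succ,
        Fin.val_castSucc]
      have := hl i
      push_cast [this]
      rw [← add_assoc, hZ_snoc]
      congr 2; ring
  rw [h1]
  refine Matrix.det_eq_of_forall_col_eq_smul_add_pred (Fin.cons 0 (fun _ => x)) ?_ ?_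
  · intro i; simp
  · intro i j
    refine Fin.cases ?_ (fun j => ?_) j
    · simp
    · simp only [Matrix.of_apply, Matrix.transpose_apply, Fin.cons_succ, Fin.val_succ,
        Fin.val_castSucc, ← Fin.succ_castSucc]
      push_cast
      rw [← add_assoc, hZ_snoc]

lemma schur_one (lam : Fin 1 → ℕ) (k : ℕ) (u : Fin k → ℝ) : schur lam u = hZ k (lam 0) u := by
  simp [schur]

lemma core_pos (l m : ℕ) (lam : Fin l → ℕ) (hl : ∀ i, 1 ≤ lam i) (U : Fin m → ℝ) (a b c : ℝ) :
    (c - a) * schur (fun i => lam i - 1)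
        (Fin.snoc (Fin.snoc U a : Fin (m+1) → ℝ) c : Fin (m+2) → ℝ)
        * schur lam (Fin.snoc U b : Fin (m+1) → ℝ)
      + (b - c) * schur (fun i => lam i - 1)
        (Fin.snoc (Fin.snoc U b : Fin (m+1) → ℝ) c : Fin (m+2) → ℝ)
        * schur lam (Fin.snoc U a : Fin (m+1) → ℝ)
      = (b - a) * schur (fun i => lam i - 1)
        (Fin.snoc (Fin.snoc U a : Fin (m+1) → ℝ) b : Fin (m+2) → ℝ)
        * schur lam (Fin.snoc U c : Fin (m+1) → ℝ) := by
  match l, lam, hl with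
  | 0, lam, hl => simp [schur]
  | 1, lam, hl =>
    simp only [schur_one]
    have h := hl 0
    push_cast [h]
    have h1 := hZ_diff m ((lam 0 : ℤ) - 1) a c U
    have h2 := hZ_diff m ((lam 0 : ℤ) - 1) b c U
    have h3 := hZ_diff m ((lam 0 : ℤ) - 1) a b U
    rw [sub_add_cancel] at h1 h2 h3
    linear_combination (- hZ (m+1) (lam 0) (Fin.snoc U b : Fin (m+1) → ℝ)) * h1
      + hZ (m+1) (lam 0) (Fin.snoc U a : Fin (m+1) → ℝ) * h2
      + hZ (m+1) (lam 0) (Fin.snoc U c : Fin (m+1) → ℝ) * h3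
  | l+2, lam, hl =>
    let W : Fin (l+1) → Fin (l+2) → ℝ := fun j i => hZ m ((lam i : ℤ) - (i : ℤ) + j + 1) U
    let v : ℝ → Fin (l+2) → ℝ := fun x i =>
      hZ (m+1) ((lam i : ℤ) - (i : ℤ)) (Fin.snoc U x : Fin (m+1) → ℝ)
    let φ : (Fin (l+2) → ℝ) → ℝ := fun p =>
      Matrix.det (Matrix.of (Fin.cons p W : Fin (l+2) → Fin (l+2) → ℝ))
    let D : (Fin (l+2) → ℝ) → (Fin (l+2) → ℝ) → ℝ := fun p q => Matrix.det (Matrix.of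
      (Fin.cons p (Fin.cons q (fun j : Fin l => W j.castSucc) : Fin (l+1) → Fin (l+2) → ℝ)
        : Fin (l+2) → Fin (l+2) → ℝ))
    have hP := plucker l W D (fun _ _ => rfl) φ (fun _ => rfl) (v c) (v b) (v a)
    have hF : ∀ x, schur lam (Fin.snoc U x : Fin (m+1) → ℝ) = φ (v x) := fun x =>
      schur_pos_snoc (l+1) m lam U x
    have hS : ∀ x y, (x - y) * schur (fun i => lam i - 1)
        (Fin.snoc (Fin.snoc U x : Fin (m+1) → ℝ) y : Fin (m+2) → ℝ) = - D (v y) (v x) := by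
      intro x y
      let g : Fin (l+2) → ℝ := fun i => hZ (m+2) ((lam i : ℤ) - (i : ℤ) - 1)
            (Fin.snoc (Fin.snoc U x : Fin (m+1) → ℝ) y : Fin (m+2) → ℝ)
      have h1 : schur (fun i => lam i - 1)
        (Fin.snoc (Fin.snoc U x : Fin (m+1) → ℝ) y : Fin (m+2) → ℝ) = D g (v x) :=
        schur_pos_snoc2 l m lam hl U x y
      have hg : ∀ i, (x - y) * g i = v x i - v y i := by
        intro i
        have := hZ_diff m ((lam i : ℤ) - (i : ℤ) - 1) x y U
        rw [sub_add_cancel] at this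
        exact this
      have h0 : D (v x) (v x) = 0 := by
        refine Matrix.det_zero_of_row_eq (i := 0) (j := 1) (by simp) ?_
        funext k; rfl
      obtain ⟨β, hβ⟩ := det_cons_linear (l+1)
        (Fin.cons (v x) (fun j : Fin l => W j.castSucc) : Fin (l+1) → Fin (l+2) → ℝ)
      have hβ' : ∀ p, D p (v x) = ∑ j, p j * β j := hβ
      rw [h1]
      have : (x - y) * D g (v x) = D (v x) (v x) - D (v y) (v x) := by
        rw [hβ', hβ', hβ', Finset.mul_sum, ← Finset.sum_sub_distrib]
        refine Finset.sum_congr rfl fun j _ => ?_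
        rw [← mul_assoc, hg, sub_mul]
      rw [this, h0, zero_sub]
    rw [hF, hF, hF]
    linear_combination (-φ (v b)) * hS a c + φ (v a) * hS b c + φ (v c) * hS a b - hP

lemma schur_last_zero (l k : ℕ) (lam : Fin (l+1) → ℕ) (h : lam (Fin.last l) = 0)
    (u : Fin k → ℝ) : schur lam u = schur (fun i : Fin l => lam i.castSucc) u := by
  unfold schur
  rw [Matrix.det_succ_row _ (Fin.last l), Fin.sum_univ_castSucc]
  rw [Finset.sum_eq_zero]
  · simp [h, hZ_zero, ← two_mul, pow_mul]
    congr 1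
  · intro j _
    have : hZ k ((lam (Fin.last l) : ℤ) - ((Fin.last l : Fin (l+1)) : ℕ) + ((j.castSucc : Fin (l+1)) : ℕ)) u = 0 := by
      apply hZ_neg
      have := j.2
      simp [h]
    rw [Matrix.of_apply, this]; simp

lemma core (l m : ℕ) (lam : Fin l → ℕ) (hl : Antitone lam) (U : Fin m → ℝ) (a b c : ℝ) :
    (c - a) * schur (fun i => lam i - 1)
        (Fin.snoc (Fin.snoc U a : Fin (m+1) → ℝ) c : Fin (m+2) → ℝ)
        * schur lam (Fin.snoc U b : Fin (m+1) → ℝ)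
      + (b - c) * schur (fun i => lam i - 1)
        (Fin.snoc (Fin.snoc U b : Fin (m+1) → ℝ) c : Fin (m+2) → ℝ)
        * schur lam (Fin.snoc U a : Fin (m+1) → ℝ)
      = (b - a) * schur (fun i => lam i - 1)
        (Fin.snoc (Fin.snoc U a : Fin (m+1) → ℝ) b : Fin (m+2) → ℝ)
        * schur lam (Fin.snoc U c : Fin (m+1) → ℝ) := by
  induction l with
  | zero => exact core_pos 0 m lam (fun i => i.elim0) U a b c
  | succ l ih =>
    by_cases h : lam (Fin.last l) = 0
    · have h' : (fun i => lam i - 1) (Fin.last l) = 0 := by simp [h]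
      simp only [schur_last_zero l _ lam h, schur_last_zero l _ (fun i => lam i - 1) h']
      exact ih (fun i => lam i.castSucc) (fun i j hij => hl (by simpa using hij))
    · refine core_pos (l+1) m lam (fun i => ?_) U a b c
      have := hl (Fin.le_last i)
      omega

/-- For a partition `λ` of length at most `m+1` with border complement `μ`, and positive
reals `U`, `a`, `b`, `t`:
`a(b−t)t^{λ₁−1}·S_μ(U,a,ab/t)·S_λ(U,b) + b(t−a)t^{λ₁−1}·S_μ(U,b,ab/t)·S_λ(U,a)`
`= (b−a)·t^{λ₁}·S_μ(U,a,b)·S_λ(U,ab/t)`. -/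
theorem schur_border_complement_identity (m : ℕ) (lam : Fin (m + 1) → ℕ) (hlam : Antitone lam)
    (U : Fin m → ℝ) (hU : ∀ i, 0 < U i) (a b t : ℝ) (ha : 0 < a) (hb : 0 < b) (ht : 0 < t) :
    a * (b - t) * t ^ ((lam 0 : ℤ) - 1)
          * schur (fun i : Fin (m + 1) => lam i - 1)
              (Fin.snoc (Fin.snoc U a : Fin (m + 1) → ℝ) (a * b / t) : Fin (m + 2) → ℝ)
          * schur lam (Fin.snoc U b : Fin (m + 1) → ℝ)
      + b * (t - a) * t ^ ((lam 0 : ℤ) - 1)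
          * schur (fun i : Fin (m + 1) => lam i - 1)
              (Fin.snoc (Fin.snoc U b : Fin (m + 1) → ℝ) (a * b / t) : Fin (m + 2) → ℝ)
          * schur lam (Fin.snoc U a : Fin (m + 1) → ℝ)
      = (b - a) * t ^ (lam 0 : ℤ)
          * schur (fun i : Fin (m + 1) => lam i - 1)
              (Fin.snoc (Fin.snoc U a : Fin (m + 1) → ℝ) b : Fin (m + 2) → ℝ)
          * schur lam (Fin.snoc U (a * b / t) : Fin (m + 1) → ℝ) := by
  have hc := core (m + 1) m lam hlam U a b (a * b / t)
  have e1 : a * (b - t) * t ^ ((lam 0 : ℤ) - 1) = t ^ (lam 0 : ℤ) * (a * b / t - a) := by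
    rw [zpow_sub_one₀ ht.ne']; field_simp
  have e2 : b * (t - a) * t ^ ((lam 0 : ℤ) - 1) = t ^ (lam 0 : ℤ) * (b - a * b / t) := by
    rw [zpow_sub_one₀ ht.ne']; field_simp
  rw [e1, e2]
  linear_combination t ^ (lam 0 : ℤ) * hc
end

section
/- Let λ be a nonempty partition of length at most n and η its border complement (each nonzero part reduced by 1). Then f_λ(n+1)·f_{η⁽⁰⁾}(n+1) / (f_η(n+2)·f_{λ⁽⁰⁾}(n)) = (n+1)/h_λ(1,1), where h_λ(1,1) = λ₁ + λ'₁ − 1 is the hook length of the corner box of λ. -/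
open Finset in
theorem hh_ones (K m : ℕ) : hh (K + 1) m (fun _ => (1 : ℝ)) = ((m + K).choose K : ℝ) := by
  have h1 : (Finset.Nat.antidiagonalTuple (K + 1) m).card = (m + K).choose K := by
    rw [← Finset.piAntidiag_univ_fin_eq_antidiagonalTuple]
    have h2 := Finset.card_finsuppAntidiag_nat_eq_choose (s := (Finset.univ : Finset (Fin (K + 1)))) m
    rw [Finset.finsuppAntidiag, Finset.card_map, Finset.card_attach] at h2
    rw [h2, Finset.card_univ, Fintype.card_fin, show K + 1 + m - 1 = m + K by omega,
      Nat.choose_symm_add]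
  simp [hh, h1]

theorem hZ_ones (K b : ℕ) (z : ℤ) (h : z + K = b) :
    hZ (K + 1) z (fun _ => (1 : ℝ)) = (b.choose K : ℝ) := by
  unfold hZ
  split_ifs with h0
  · rw [hh_ones, show z.toNat + K = b by omega]
  · rw [Nat.choose_eq_zero_of_lt (by omega), Nat.cast_zero]

/-- Shifted parts. -/
def aa {l : ℕ} (lam : Fin l → ℕ) (i : Fin l) : ℕ := lam i + (Fin.rev i : ℕ)

theorem choose_split (l d j a : ℕ) (hj : j < l) :
    ((a + (d + 1) + j).choose (l + d) : ℝ)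
      = ∑ r : Fin l, ((a + (d + 1)).choose (d + 1 + (Fin.rev r : ℕ)) : ℝ) * (j.choose r : ℝ) := by
  rw [add_comm (a + (d + 1)) j, Nat.add_choose_eq, Finset.Nat.sum_antidiagonal_eq_sum_range_succ_mk,
    show (l + d).succ = l + (d + 1) by omega, Finset.sum_range_add]
  rw [Finset.sum_eq_zero (s := Finset.range (d + 1)), add_zero, Finset.sum_range]
  · push_cast
    refine Finset.sum_congr rfl fun r _ => ?_
    rw [mul_comm, show l + d - (r : ℕ) = d + 1 + (Fin.rev r : ℕ) by rw [Fin.val_rev]; omega]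
  · intro x _
    simp only []
    rw [Nat.choose_eq_zero_of_lt (show j < l + x by omega), zero_mul]

theorem det_desc (l : ℕ) (a : Fin l → ℕ) :
    Matrix.det (Matrix.of fun i j : Fin l => ((a i).descFactorial (Fin.rev j : ℕ) : ℝ))
      = ∏ i, ∏ j ∈ Finset.Ioi i, ((a i : ℝ) - a j) := by
  have h1 := Matrix.det_eval_matrixOfPolynomials_eq_det_vandermonde (fun i => (a i : ℝ))
    (fun j : Fin l => descPochhammer ℝ (j : ℕ)) (fun j => descPochhammer_natDegree ℝ _)
    (fun j => monic_descPochhammer ℝ _)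
  simp only [descPochhammer_eval_eq_descFactorial] at h1
  have h2 := Matrix.det_permute' (Fin.revPerm : Equiv.Perm (Fin l))
    (Matrix.of fun i j : Fin l => ((a i).descFactorial (j : ℕ) : ℝ))
  have h3 := Matrix.det_permute' (Fin.revPerm : Equiv.Perm (Fin l))
    (Matrix.vandermonde fun i => (a i : ℝ))
  have h4 := Matrix.det_projVandermonde (fun _ : Fin l => (1 : ℝ)) (fun i => (a i : ℝ))
  rw [← h1, ← h3] at h2
  have h5 : (Matrix.vandermonde fun i => (a i : ℝ)).submatrix id (Fin.revPerm : Equiv.Perm (Fin l))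
      = Matrix.projVandermonde (fun _ : Fin l => (1 : ℝ)) (fun i => (a i : ℝ)) := by
    ext i j
    simp [Matrix.vandermonde_apply, Matrix.projVandermonde_apply]
  rw [h5, h4] at h2
  simp only [one_mul] at h2
  exact h2

theorem schur_ones (l d : ℕ) (lam : Fin l → ℕ) :
    schur lam (fun _ : Fin (l + d + 1) => (1 : ℝ))
      = (∏ i, ((aa lam i + (d + 1)).descFactorial (d + 1) : ℝ))
        * ((∏ j : Fin l, (((d + 1 + (Fin.rev j : ℕ)).factorial : ℝ))⁻¹)
        * ∏ i, ∏ j ∈ Finset.Ioi i, ((aa lam i : ℝ) - aa lam j)) := by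
  have hM : (Matrix.of fun i j : Fin l =>
        hZ (l + d + 1) ((lam i : ℤ) - (i : ℤ) + (j : ℤ)) (fun _ => (1 : ℝ)))
      = (Matrix.of fun i j : Fin l =>
          ((aa lam i + (d + 1)).choose (d + 1 + (Fin.rev j : ℕ)) : ℝ))
        * (Matrix.of fun r j : Fin l => ((j : ℕ).choose (r : ℕ) : ℝ)) := by
    ext i j
    rw [Matrix.mul_apply]
    simp only [Matrix.of_apply]
    rw [← choose_split l d j (aa lam i) j.2]
    apply hZ_ones
    unfold aa
    rw [Fin.val_rev]
    have := i.2
    push_cast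
    omega
  have hU : (Matrix.of fun r j : Fin l => ((j : ℕ).choose (r : ℕ) : ℝ)).det = 1 := by
    rw [Matrix.det_of_isUpperTriangular]
    · simp
    · intro i j hij
      simp only [Matrix.of_apply]
      rw [Nat.choose_eq_zero_of_lt (by exact hij), Nat.cast_zero]
  have hN : (Matrix.of fun i j : Fin l =>
          ((aa lam i + (d + 1)).choose (d + 1 + (Fin.rev j : ℕ)) : ℝ))
      = Matrix.of fun i j : Fin l => ((aa lam i + (d + 1)).descFactorial (d + 1) : ℝ) *
        (Matrix.of fun i j : Fin l => (((d + 1 + (Fin.rev j : ℕ)).factorial : ℝ))⁻¹ *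
          (Matrix.of fun i j : Fin l => ((aa lam i).descFactorial (Fin.rev j : ℕ) : ℝ)) i j) i j := by
    ext i j
    simp only [Matrix.of_apply]
    have h1 := Nat.descFactorial_mul_descFactorial (n := aa lam i + (d + 1))
      (Nat.le_add_right (d + 1) (Fin.rev j : ℕ))
    rw [Nat.add_sub_cancel, Nat.add_sub_cancel_left, Nat.descFactorial_eq_factorial_mul_choose _ (d + 1 + _)] at h1
    have h2 : ((d + 1 + (Fin.rev j : ℕ)).factorial : ℝ) ≠ 0 := by positivity
    field_simp
    have h3 := congrArg (Nat.cast (R := ℝ)) h1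
    push_cast at h3 ⊢
    linarith
  unfold schur
  rw [hM, Matrix.det_mul, hU, mul_one, hN, Matrix.det_mul_column, Matrix.det_mul_row, det_desc]

theorem aa_tail (l : ℕ) (lam : Fin (l + 1) → ℕ) (j : Fin l) :
    aa (fun i : Fin l => lam i.succ) j = aa lam j.succ := by
  unfold aa
  simp only [Fin.val_rev, Fin.val_succ]
  omega

theorem schur_step (l d : ℕ) (lam : Fin (l + 1) → ℕ) :
    schur lam (fun _ : Fin (l + 1 + d + 1) => (1 : ℝ))
      = schur (fun i : Fin l => lam i.succ) (fun _ : Fin (l + d + 1) => (1 : ℝ))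
        * (((aa lam 0 + (d + 1)).descFactorial (d + 1) : ℝ) * ((l + d + 1).factorial : ℝ)⁻¹
          * ∏ j : Fin l, ((aa lam 0 : ℝ) - aa lam j.succ)) := by
  rw [schur_ones, schur_ones]
  simp only [aa_tail]
  rw [Fin.prod_univ_succ, Fin.prod_univ_succ (f := fun j : Fin (l + 1) => (((d + 1 + (Fin.rev j : ℕ)).factorial : ℝ))⁻¹),
    Fin.prod_univ_succ (f := fun i : Fin (l + 1) => ∏ j ∈ Finset.Ioi i, ((aa lam i : ℝ) - aa lam j)),
    Fin.prod_Ioi_zero]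
  simp only [Fin.prod_Ioi_succ]
  have h1 : ∀ j : Fin l, (Fin.rev j.succ : ℕ) = (Fin.rev j : ℕ) := by
    intro j; simp only [Fin.val_rev, Fin.val_succ]; omega
  simp only [h1]
  rw [show d + 1 + ((Fin.rev (0 : Fin (l + 1)) : Fin (l + 1)) : ℕ) = l + d + 1 by
    simp [Fin.val_rev]; omega]
  ring

theorem schur_pos (l d : ℕ) (lam : Fin l → ℕ) (h : Antitone lam) :
    0 < schur lam (fun _ : Fin (l + d + 1) => (1 : ℝ)) := by
  rw [schur_ones]
  refine mul_pos (Finset.prod_pos fun i _ => ?_) (mul_pos (Finset.prod_pos fun i _ => by positivity)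
    (Finset.prod_pos fun i _ => Finset.prod_pos fun j hj => ?_))
  · exact_mod_cast Nat.descFactorial_pos.2 (by omega)
  · rw [Finset.mem_Ioi] at hj
    have h1 := h hj.le
    rw [sub_pos, Nat.cast_lt]
    unfold aa
    simp only [Fin.val_rev]
    have h2 : (i : ℕ) < j := hj
    have := j.2
    omega

theorem telescope (m : ℕ) : ∀ (lam : Fin (m + 1) → ℕ), Antitone lam → 1 ≤ lam 0 →
    (∏ j : Fin m, ((lam 0 : ℝ) - lam j.succ + j + 1))
      * ((lam 0 : ℝ) + ((Finset.univ.filter fun i : Fin (m + 1) => 1 ≤ lam i).card : ℝ) - 1)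
    = ((lam 0 : ℝ) + m) *
      ∏ j : Fin m, ((lam 0 : ℝ) - 1 - ((lam j.succ - 1 : ℕ) : ℝ) + j + 1) := by
  induction m with
  | zero =>
    intro lam _ h0
    have : (Finset.univ.filter fun i : Fin (0 + 1) => 1 ≤ lam i) = Finset.univ := by
      ext i; fin_cases i; simpa using h0
    rw [this]; simp
  | succ m ih =>
    intro lam hl h0
    by_cases hlast : 1 ≤ lam (Fin.last (m + 1))
    · have hall : ∀ i, 1 ≤ lam i := fun i => hlast.trans (hl (Fin.le_last i))
      rw [Finset.filter_true_of_mem (fun i _ => hall i), Finset.card_univ, Fintype.card_fin, mul_comm]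
      congr 1
      · push_cast; ring
      · refine Finset.prod_congr rfl fun j _ => ?_
        rw [Nat.cast_sub (hall _)]; push_cast; ring
    · have hz : lam (Fin.last (m + 1)) = 0 := by omega
      have h := ih (fun i => lam i.castSucc) (fun i j hij => hl (by simpa using hij)) (by simpa using h0)
      have hc : (Finset.univ.filter fun i : Fin (m + 1 + 1) => 1 ≤ lam i).card
          = (Finset.univ.filter fun i : Fin (m + 1) => 1 ≤ lam i.castSucc).card := by
        simp only [Finset.card_filter]
        rw [Fin.sum_univ_castSucc, hz]; simp
      rw [hc, Fin.prod_univ_castSucc, Fin.prod_univ_castSucc]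
      simp only [Fin.succ_castSucc, Fin.succ_last, hz, Fin.castSucc_zero, Fin.val_castSucc, Fin.val_last] at h ⊢
      push_cast at h ⊢
      linear_combination ((lam 0 : ℝ) + m + 1) * h

/-- For a nonempty partition `λ` of length at most `n = m+1` with border complement `η`:
`f_λ(n+1)·f_{η⁽⁰⁾}(n+1) / (f_η(n+2)·f_{λ⁽⁰⁾}(n)) = (n+1)/h_λ(1,1)`, where
`h_λ(1,1) = λ₁ + λ'₁ − 1` and `f_μ(m) = S_μ(1,…,1)` (m ones). -/
theorem hook_ratio_border_complement (m : ℕ) (lam : Fin (m + 1) → ℕ) (hlam : Antitone lam)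
    (hne : 1 ≤ lam 0) :
    schur lam (fun _ : Fin (m + 2) => (1 : ℝ))
          * schur (fun i : Fin m => lam i.succ - 1) (fun _ : Fin (m + 2) => (1 : ℝ))
        / (schur (fun i : Fin (m + 1) => lam i - 1) (fun _ : Fin (m + 3) => (1 : ℝ))
            * schur (fun i : Fin m => lam i.succ) (fun _ : Fin (m + 1) => (1 : ℝ)))
      = (m + 2 : ℝ)
          / ((lam 0 : ℝ) + ((Finset.univ.filter fun i : Fin (m + 1) => 1 ≤ lam i).card : ℝ) - 1) := by
  have hl0 : Antitone (fun i : Fin m => lam i.succ) := fun i j hij => hlam (by simpa using hij)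
  have hl1 : Antitone (fun i : Fin m => lam i.succ - 1) :=
    fun i j hij => Nat.sub_le_sub_right (hl0 hij) 1
  have hl2 : Antitone (fun i : Fin (m + 1) => lam i - 1) :=
    fun i j hij => Nat.sub_le_sub_right (hlam hij) 1
  have pB : 0 < schur (fun i : Fin m => lam i.succ - 1) (fun _ : Fin (m + 2) => (1 : ℝ)) :=
    schur_pos m 1 _ hl1
  have pD : 0 < schur (fun i : Fin m => lam i.succ) (fun _ : Fin (m + 1) => (1 : ℝ)) :=
    schur_pos m 0 _ hl0
  have sA : schur lam (fun _ : Fin (m + 2) => (1 : ℝ)) = _ := schur_step m 0 lam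
  have sC : schur (fun i : Fin (m + 1) => lam i - 1) (fun _ : Fin (m + 1 + 1 + 1) => (1 : ℝ)) = _ :=
    schur_step m 1 (fun i => lam i - 1)
  have pC : 0 < schur (fun i : Fin (m + 1) => lam i - 1) (fun _ : Fin (m + 3) => (1 : ℝ)) :=
    schur_pos (m + 1) 1 _ hl2
  have ht := telescope m lam hlam hne
  have hp : 0 < (lam 0 : ℝ)
      + ((Finset.univ.filter fun i : Fin (m + 1) => 1 ≤ lam i).card : ℝ) - 1 := by
    have h1 : (1 : ℝ) ≤ lam 0 := by exact_mod_cast hne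
    have h2 : 0 < (Finset.univ.filter fun i : Fin (m + 1) => 1 ≤ lam i).card :=
      Finset.card_pos.2 ⟨0, by simpa using hne⟩
    have h3 : (0 : ℝ) < ((Finset.univ.filter fun i : Fin (m + 1) => 1 ≤ lam i).card : ℝ) := by
      exact_mod_cast h2
    linarith
  have hA : ∏ j : Fin m, ((aa lam 0 : ℝ) - aa lam j.succ)
      = ∏ j : Fin m, ((lam 0 : ℝ) - lam j.succ + j + 1) := by
    refine Finset.prod_congr rfl fun j _ => ?_
    have h1 : (Fin.rev (0 : Fin (m + 1)) : ℕ) = (Fin.rev j.succ : ℕ) + j + 1 := by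
      have := j.2
      simp only [Fin.val_rev, Fin.val_succ, Fin.val_zero]; omega
    unfold aa
    rw [h1]; push_cast; ring
  have hC : ∏ j : Fin m, ((aa (fun i => lam i - 1) 0 : ℝ) - aa (fun i => lam i - 1) j.succ)
      = ∏ j : Fin m, ((lam 0 : ℝ) - 1 - ((lam j.succ - 1 : ℕ) : ℝ) + j + 1) := by
    refine Finset.prod_congr rfl fun j _ => ?_
    have h1 : (Fin.rev (0 : Fin (m + 1)) : ℕ) = (Fin.rev j.succ : ℕ) + j + 1 := by
      have := j.2
      simp only [Fin.val_rev, Fin.val_succ, Fin.val_zero]; omega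
    unfold aa
    rw [h1]; push_cast [Nat.cast_sub hne]; ring
  rw [hA] at sA
  rw [hC] at sC
  have d1 : ((aa lam 0 + (0 + 1)).descFactorial (0 + 1) : ℝ) = lam 0 + m + 1 := by
    simp [aa, Fin.val_rev]
  have d2 : ((aa (fun i => lam i - 1) 0 + (1 + 1)).descFactorial (1 + 1) : ℝ)
      = ((lam 0 : ℝ) + m + 1) * (lam 0 + m) := by
    have : aa (fun i => lam i - 1) 0 + (1 + 1) = lam 0 + m + 1 := by
      simp [aa, Fin.val_rev]; omega
    rw [this]
    simp [Nat.descFactorial_succ]; ring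
  rw [d1] at sA
  rw [d2] at sC
  rw [div_eq_div_iff (mul_pos pC pD).ne' hp.ne', sA, sC]
  have hf : ((m + 1 + 1).factorial : ℝ) = (m + 2) * ((m + 0 + 1).factorial : ℝ) := by
    rw [Nat.factorial_succ]; push_cast; ring
  have hf0 : ((m + 0 + 1).factorial : ℝ) ≠ 0 := by positivity
  have hm : (m + 2 : ℝ) ≠ 0 := by positivity
  rw [hf]
  generalize schur (fun i : Fin m => lam i.succ - 1) _ = B at *
  generalize schur (fun i : Fin m => lam i.succ) _ = D at *
  field_simp
  linear_combination ht
end
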